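/- Let (X,d_X) and (Y,d_Y) be bounded metric spaces, each with at least two points. Suppose T : LPM(X,d_X) → LPM(Y,d_Y) is a bijective sup-metric isometry satisfying T(Pp(X) ∩ LPM(X,d_X)) = Pp(Y) ∩ LPM(Y,d_Y). Then there exists a bi-Lipschitz homeomorphism ϕ : Y → X (a bijection with λ ≥ 1 such that (1/λ)·d_Y(x,y) ≤ d_X(ϕ(x),ϕ(y)) ≤ λ·d_Y(x,y) for all x,y ∈ Y) such that T(d)(x,y) = d(ϕ(x), ϕ(y)) for every d ∈ LPM(X,d_X) and all x,y ∈ Y. If moreover neither X nor Y has exactly two points, then ϕ is unique. -/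

import Mathlib

open Set Filter

namespace BanachStone

/-- `d` is a pseudometric. -/
def IsPseudometric {Z : Type*} (d : Z → Z → ℝ) : Prop :=
  (∀ z, d z z = 0) ∧ (∀ z w, d z w = d w z) ∧ (∀ z w v, d z v ≤ d z w + d w v)

/-- `d` is bounded. -/
def IsBoundedPM {Z : Type*} (d : Z → Z → ℝ) : Prop := ∃ C : ℝ, ∀ z w, d z w ≤ C

/-- The sup-norm of `d`. -/
noncomputable def supNorm {Z : Type*} (d : Z → Z → ℝ) : ℝ := ⨆ p : Z × Z, d p.1 p.2

/-- The sup-metric between `d` and `ρ`. -/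
noncomputable def supDist {Z : Type*} (d ρ : Z → Z → ℝ) : ℝ :=
  ⨆ p : Z × Z, |d p.1 p.2 - ρ p.1 p.2|

/-- `PM Z`: bounded continuous pseudometrics on `Z`. -/
def PM (Z : Type*) [TopologicalSpace Z] : Set (Z → Z → ℝ) :=
  {d | IsPseudometric d ∧ IsBoundedPM d ∧ Continuous fun p : Z × Z => d p.1 p.2}

/-- The topology induced by `d` (generated by open `d`-balls). -/
def metricTopology {Z : Type*} (d : Z → Z → ℝ) : TopologicalSpace Z :=
  TopologicalSpace.generateFrom {s | ∃ z : Z, ∃ r : ℝ, s = {w | d z w < r}}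

/-- `AM Z`: admissible metrics, i.e. bounded metrics inducing the topology of `Z`. -/
def AM (Z : Type*) [t : TopologicalSpace Z] : Set (Z → Z → ℝ) :=
  {d | IsPseudometric d ∧ IsBoundedPM d ∧ (∀ z w : Z, z ≠ w → 0 < d z w) ∧
    metricTopology d = t}

/-- `Pp Z`: elements of `PM Z` attaining the sup-norm at exactly one unordered pair
of distinct points. -/
def Pp (Z : Type*) [TopologicalSpace Z] : Set (Z → Z → ℝ) :=
  {d | d ∈ PM Z ∧ ∃ z w : Z, z ≠ w ∧ d z w = supNorm d ∧
    ∀ z' w' : Z, z' ≠ w' → d z' w' = supNorm d → ({z', w'} : Set Z) = {z, w}}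

/-- `UPM Z`: bounded pseudometrics uniformly continuous w.r.t. the uniformity of `Z`. -/
def UPM (Z : Type*) [UniformSpace Z] : Set (Z → Z → ℝ) :=
  {d | IsPseudometric d ∧ IsBoundedPM d ∧
    ∀ ε : ℝ, 0 < ε → ∃ U ∈ uniformity Z, ∀ x y : Z, (x, y) ∈ U → d x y < ε}

/-- `UC Z`: bounded uniformly continuous real-valued functions on `Z`. -/
def UC (Z : Type*) [UniformSpace Z] : Set (Z → ℝ) :=
  {f | (∃ C : ℝ, ∀ z, |f z| ≤ C) ∧ UniformContinuous f}

/-- The space `U(Z)`. -/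
def Ucal (Z : Type*) [UniformSpace Z] : Set (Z → Z → ℝ) :=
  {d | d ∈ PM Z ∧ ∀ ε : ℝ, 0 < ε → ∃ F : Finset (Z → ℝ), F.Nonempty ∧
    (↑F : Set (Z → ℝ)) ⊆ UC Z ∧ ∃ δ : ℝ, 0 < δ ∧
    ∀ x y : Z, (∀ f ∈ F, |f x - f y| < δ) → d x y < ε}

/-- The uniformity filter of the coarsest uniformity on `Z` making every bounded
uniformly continuous real-valued function on `Z` uniformly continuous. -/
noncomputable def U0 (Z : Type*) [UniformSpace Z] : Filter (Z × Z) :=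
  ⨅ f ∈ UC Z, Filter.comap (fun p : Z × Z => (f p.1, f p.2)) (uniformity ℝ)

/-- The Lipschitz constant of a pseudometric on a metric space. -/
noncomputable def lip {Z : Type*} [PseudoMetricSpace Z] (d : Z → Z → ℝ) : ENNReal :=
  ⨆ (x : Z) (y : Z) (_ : x ≠ y), ENNReal.ofReal (d x y / dist x y)

/-- `LPM Z`: bounded Lipschitz continuous pseudometrics on `Z`. -/
def LPM (Z : Type*) [MetricSpace Z] : Set (Z → Z → ℝ) :=
  {d | IsPseudometric d ∧ IsBoundedPM d ∧ lip d < ⊤}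

/-- `LPM_k Z`: elements of `LPM Z` with Lipschitz constant `< k`. -/
def LPMlt (k : ℝ) (Z : Type*) [MetricSpace Z] : Set (Z → Z → ℝ) :=
  {d | d ∈ LPM Z ∧ lip d < ENNReal.ofReal k}

/-- `\overline{LPM}_k Z`: elements of `LPM Z` with Lipschitz constant `≤ k`. -/
def LPMle (k : ℝ) (Z : Type*) [MetricSpace Z] : Set (Z → Z → ℝ) :=
  {d | d ∈ LPM Z ∧ lip d ≤ ENNReal.ofReal k}

/-- `Z` has exactly two points. -/
def ExactlyTwo (Z : Type*) : Prop := ∃ a b : Z, a ≠ b ∧ ∀ c : Z, c = a ∨ c = b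

/-- The two-element subsets of `Z`. -/
def Dset (Z : Type*) : Set (Set Z) := {s | ∃ a b : Z, a ≠ b ∧ s = {a, b}}

section Pseudometrics

variable {Z : Type*}

lemma IsPseudometric.nonneg {d : Z → Z → ℝ} (h : IsPseudometric d) (z w : Z) : 0 ≤ d z w := by
  obtain ⟨h0, hs, ht⟩ := h
  have h1 := ht z w z
  rw [h0, hs w z] at h1
  linarith

lemma isPseudometric_abs_sub (f : Z → ℝ) : IsPseudometric fun u v => |f u - f v| :=
  ⟨fun _ => by simp, fun _ _ => abs_sub_comm _ _, fun _ _ _ => abs_sub_le _ _ _⟩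

lemma IsPseudometric.const_mul {d : Z → Z → ℝ} (h : IsPseudometric d) {t : ℝ} (ht : 0 ≤ t) :
    IsPseudometric fun u v => t * d u v := by
  refine ⟨fun z => by simp [h.1 z], fun z w => by simp only [h.2.1 z w], fun z w v => ?_⟩
  rw [← mul_add]
  exact mul_le_mul_of_nonneg_left (h.2.2 z w v) ht

lemma supDist_le [Nonempty Z] {d e : Z → Z → ℝ} {c : ℝ} (h : ∀ u v, |d u v - e u v| ≤ c) :
    supDist d e ≤ c :=
  ciSup_le fun p => h p.1 p.2

lemma abs_sub_le_supDist {d e : Z → Z → ℝ} (hd : IsPseudometric d) (he : IsPseudometric e)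
    (bd : IsBoundedPM d) (be : IsBoundedPM e) (u v : Z) : |d u v - e u v| ≤ supDist d e := by
  obtain ⟨C, hC⟩ := bd
  obtain ⟨C', hC'⟩ := be
  refine le_ciSup (f := fun p : Z × Z => |d p.1 p.2 - e p.1 p.2|) ⟨C + C', ?_⟩ (u, v)
  rintro _ ⟨p, rfl⟩
  have := hd.nonneg p.1 p.2
  have := he.nonneg p.1 p.2
  have := hC p.1 p.2
  have := hC' p.1 p.2
  exact abs_le.2 ⟨by linarith, by linarith⟩

lemma supDist_zero_left {d : Z → Z → ℝ} (hd : IsPseudometric d) :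
    supDist 0 d = supNorm d := by
  unfold supDist supNorm
  congr 1
  ext p
  simp [abs_of_nonneg (hd.nonneg p.1 p.2)]

variable [MetricSpace Z]

lemma mem_LPM_iff {d : Z → Z → ℝ} :
    d ∈ LPM Z ↔ IsPseudometric d ∧ IsBoundedPM d ∧
      ∃ L : ℝ, 0 ≤ L ∧ ∀ u v, d u v ≤ L * dist u v := by
  refine and_congr_right fun hd => and_congr_right fun _ => ⟨fun h => ?_, ?_⟩
  · refine ⟨(lip d).toReal, ENNReal.toReal_nonneg, fun u v => ?_⟩
    by_cases huv : u = v
    · subst huv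
      simp [hd.1 u]
    have h1 : ENNReal.ofReal (d u v / dist u v) ≤ lip d :=
      le_iSup_of_le u (le_iSup_of_le v (le_iSup_of_le huv le_rfl))
    have h2 := (ENNReal.ofReal_le_iff_le_toReal h.ne).1 h1
    exact (div_le_iff₀ (dist_pos.2 huv)).1 h2
  · rintro ⟨L, -, hL⟩
    refine lt_of_le_of_lt ?_ (ENNReal.ofReal_lt_top (r := L))
    refine iSup_le fun u => iSup_le fun v => iSup_le fun huv => ENNReal.ofReal_le_ofReal ?_
    exact (div_le_iff₀ (dist_pos.2 huv)).2 (hL u v)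

lemma LPM.abs_sub_le_supDist {d e : Z → Z → ℝ} (hd : d ∈ LPM Z) (he : e ∈ LPM Z) (u v : Z) :
    |d u v - e u v| ≤ supDist d e :=
  BanachStone.abs_sub_le_supDist hd.1 he.1 hd.2.1 he.2.1 u v

lemma zero_mem_LPM : (0 : Z → Z → ℝ) ∈ LPM Z :=
  mem_LPM_iff.2 ⟨⟨by simp, by simp, by simp⟩, ⟨0, by simp⟩, 0, le_rfl, by simp⟩

lemma dist_mem_LPM (hZ : ∃ C : ℝ, ∀ a b : Z, dist a b ≤ C) : (dist : Z → Z → ℝ) ∈ LPM Z :=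
  mem_LPM_iff.2 ⟨⟨dist_self, dist_comm, dist_triangle⟩, hZ, 1, zero_le_one, by simp⟩

lemma LPM.le_supNorm {d : Z → Z → ℝ} (hd : d ∈ LPM Z) (u v : Z) : d u v ≤ supNorm d := by
  have := LPM.abs_sub_le_supDist zero_mem_LPM hd u v
  rw [supDist_zero_left hd.1] at this
  exact le_trans (by simpa using le_abs_self (d u v)) this

lemma LPM.const_mul {d : Z → Z → ℝ} (hd : d ∈ LPM Z) {t : ℝ} (ht : 0 ≤ t) :
    (fun u v => t * d u v) ∈ LPM Z := by
  obtain ⟨h, ⟨C, hC⟩, L, hL0, hL⟩ := mem_LPM_iff.1 hd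
  refine mem_LPM_iff.2 ⟨h.const_mul ht, ⟨t * C, fun u v => ?_⟩, t * L, by positivity, fun u v => ?_⟩
  · exact mul_le_mul_of_nonneg_left (hC u v) ht
  · rw [mul_assoc]
    exact mul_le_mul_of_nonneg_left (hL u v) ht

lemma LPM_subset_PM : LPM Z ⊆ PM Z := by
  intro d hd
  obtain ⟨h, hb, L, hL0, hL⟩ := mem_LPM_iff.1 hd
  refine ⟨h, hb, ?_⟩
  refine (LipschitzWith.of_le_add_mul (K := ⟨2 * L, by positivity⟩) fun p q => ?_).continuous
  have h1 := h.2.2 p.1 q.1 p.2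
  have h2 := h.2.2 q.1 q.2 p.2
  have h3 := hL p.1 q.1
  have h4 := hL q.2 p.2
  have h5 : dist p.1 q.1 ≤ dist p q := le_max_left _ _
  have h6 : dist q.2 p.2 ≤ dist p q := by
    rw [dist_comm]
    exact le_max_right _ _
  have h7 := mul_le_mul_of_nonneg_left h5 hL0
  have h8 := mul_le_mul_of_nonneg_left h6 hL0
  change d p.1 p.2 ≤ d q.1 q.2 + 2 * L * dist p q
  linarith

/-- Bumps of opposite sign at `x` and `y`, with disjoint supports. -/
noncomputable def twoBump (x y : Z) (u : Z) : ℝ :=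
  max 0 (dist x y / 2 - dist u x) - max 0 (dist x y / 2 - dist u y)

/-- A Lipschitz pseudometric attaining its norm `dist x y` exactly at `{x, y}`, and decreasing
away from this pair at linear speed. -/
noncomputable def peak (x y : Z) (u v : Z) : ℝ := |twoBump x y u - twoBump x y v|

lemma peak_le (x y u v : Z) :
    peak x y u v ≤ dist x y - (dist u x + dist v y) ∨
    peak x y u v ≤ dist x y - (dist u y + dist v x) ∨
    peak x y u v ≤ dist x y / 2 := by
  have h1 := dist_triangle_left x y u
  have h2 := dist_triangle_left x y v
  have := dist_nonneg (x := x) (y := y)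
  have := dist_nonneg (x := u) (y := x)
  have := dist_nonneg (x := u) (y := y)
  have := dist_nonneg (x := v) (y := x)
  have := dist_nonneg (x := v) (y := y)
  unfold peak twoBump
  simp only [abs_le']
  generalize dist x y = D at *
  generalize dist u x = a at *
  generalize dist u y = b at *
  generalize dist v x = a' at *
  generalize dist v y = b' at *
  rcases max_cases 0 (D / 2 - a) with ⟨e1, _⟩ | ⟨e1, _⟩ <;>
  rcases max_cases 0 (D / 2 - b) with ⟨e2, _⟩ | ⟨e2, _⟩ <;>
  rcases max_cases 0 (D / 2 - a') with ⟨e3, _⟩ | ⟨e3, _⟩ <;>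
  rcases max_cases 0 (D / 2 - b') with ⟨e4, _⟩ | ⟨e4, _⟩ <;>
  rw [e1, e2, e3, e4] <;>
  first
  | exact Or.inl ⟨by linarith, by linarith⟩
  | exact Or.inr (Or.inl ⟨by linarith, by linarith⟩)
  | exact Or.inr (Or.inr ⟨by linarith, by linarith⟩)

lemma peak_le_dist (x y u v : Z) : peak x y u v ≤ dist x y := by
  have := dist_nonneg (x := u) (y := x)
  have := dist_nonneg (x := u) (y := y)
  have := dist_nonneg (x := v) (y := x)
  have := dist_nonneg (x := v) (y := y)
  have := dist_nonneg (x := x) (y := y)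
  rcases peak_le x y u v with h | h | h <;> linarith

lemma peak_self (x y : Z) : peak x y x y = dist x y := by
  have h := dist_nonneg (x := x) (y := y)
  unfold peak twoBump
  rw [dist_self, dist_self, dist_comm y x, max_eq_right (by linarith), max_eq_left (by linarith),
    abs_of_nonneg (by linarith)]
  ring

lemma eq_of_dist_le_peak {x y u v : Z} (hxy : x ≠ y) (h : dist x y ≤ peak x y u v) :
    s(u, v) = s(x, y) := by
  have := dist_nonneg (x := u) (y := x)
  have := dist_nonneg (x := u) (y := y)
  have := dist_nonneg (x := v) (y := x)
  have := dist_nonneg (x := v) (y := y)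
  have := dist_pos.2 hxy
  rw [Sym2.eq_iff]
  rcases peak_le x y u v with h' | h' | h'
  · exact Or.inl ⟨dist_le_zero.1 (by linarith), dist_le_zero.1 (by linarith)⟩
  · exact Or.inr ⟨dist_le_zero.1 (by linarith), dist_le_zero.1 (by linarith)⟩
  · linarith

lemma peak_mem_LPM (x y : Z) : peak x y ∈ LPM Z := by
  refine mem_LPM_iff.2 ⟨isPseudometric_abs_sub _, ⟨_, peak_le_dist x y⟩, 2, by norm_num,
    fun u v => ?_⟩
  have key : ∀ w, |max 0 (dist x y / 2 - dist u w) - max 0 (dist x y / 2 - dist v w)| ≤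
      dist u v := fun w => by
    refine (abs_max_sub_max_le_max _ _ _ _).trans (max_le (by simp) ?_)
    rw [sub_sub_sub_cancel_left, abs_sub_comm]
    exact abs_dist_sub_le u v w
  have h1 := abs_le.1 (key x)
  have h2 := abs_le.1 (key y)
  unfold peak twoBump
  exact abs_le.2 ⟨by linarith, by linarith⟩

lemma supNorm_const_mul_peak {x y : Z} {t : ℝ} (ht : 0 ≤ t) :
    supNorm (fun u v => t * peak x y u v) = t * dist x y := by
  have : Nonempty Z := ⟨x⟩
  refine le_antisymm (ciSup_le fun p => mul_le_mul_of_nonneg_left (peak_le_dist _ _ _ _) ht) ?_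
  have := LPM.le_supNorm (LPM.const_mul (peak_mem_LPM x y) ht) x y
  rwa [peak_self] at this

lemma const_mul_peak_mem_Pp {x y : Z} (hxy : x ≠ y) {t : ℝ} (ht : 0 < t) :
    (fun u v => t * peak x y u v) ∈ Pp Z ∩ LPM Z := by
  have hm := LPM.const_mul (peak_mem_LPM x y) ht.le
  refine ⟨⟨LPM_subset_PM hm, x, y, hxy, ?_, fun u v _ h => ?_⟩, hm⟩
  · simp only [supNorm_const_mul_peak ht.le, peak_self]
  · rw [supNorm_const_mul_peak ht.le] at h
    have h' := eq_of_dist_le_peak hxy (mul_left_cancel₀ ht.ne' h).ge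
    rcases Sym2.eq_iff.1 h' with ⟨rfl, rfl⟩ | ⟨rfl, rfl⟩
    · rfl
    · exact Set.pair_comm _ _

/-- Evaluation at `(x, y)` is read off from the distances to large multiples of `peak x y`. -/
lemma exists_supDist_peak_le {d : Z → Z → ℝ} (hd : d ∈ LPM Z) {x y : Z} (hxy : x ≠ y) :
    ∃ t₀ : ℝ, ∀ t ≥ t₀, supDist d (fun u v => t * peak x y u v) ≤ t * dist x y - d x y := by
  obtain ⟨h, ⟨C, hC⟩, L, hL0, hL⟩ := mem_LPM_iff.1 hd
  have : Nonempty Z := ⟨x⟩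
  have hD := dist_pos.2 hxy
  refine ⟨max L (2 * C / dist x y), fun t ht => supDist_le fun u v => ?_⟩
  have htL : L ≤ t := (le_max_left _ _).trans ht
  have htC : 2 * C ≤ t * dist x y := (div_le_iff₀ hD).1 ((le_max_right _ _).trans ht)
  have ht0 : 0 ≤ t := hL0.trans htL
  have hxyC := hC x y
  have huvC := hC u v
  have hp : 0 ≤ t * peak x y u v := mul_nonneg ht0 (abs_nonneg _)
  have huv := h.nonneg u v
  have near : ∀ a b, d x y ≤ d a b + L * (dist a x + dist b y) := fun a b => by
    have h1 := h.2.2 x a y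
    have h2 := h.2.2 a b y
    have h3 := hL x a
    have h4 := hL b y
    rw [dist_comm] at h3
    linarith
  have far : ∀ s, 0 ≤ s → L * s ≤ t * s := fun s hs => mul_le_mul_of_nonneg_right htL hs
  refine abs_le.2 ⟨?_, by linarith⟩
  rcases peak_le x y u v with h' | h' | h'
  · have h1 := mul_le_mul_of_nonneg_left h' ht0
    have h2 := near u v
    have h3 := far (dist u x + dist v y) (by positivity)
    linarith
  · have h1 := mul_le_mul_of_nonneg_left h' ht0
    have h2 := near v u
    have h3 := far (dist u y + dist v x) (by positivity)
    rw [h.2.1 v u] at h2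
    linarith
  · have h1 := mul_le_mul_of_nonneg_left h' ht0
    linarith

lemma eq_of_forall_LPM_le {x y x' y' : Z} (hxy : x ≠ y)
    (h : ∀ d ∈ LPM Z, d x y ≤ d x' y') : s(x', y') = s(x, y) := by
  have := h _ (peak_mem_LPM x y)
  rw [peak_self] at this
  exact eq_of_dist_le_peak hxy this

lemma mem_of_forall_LPM_le_add (hZ : ∃ C : ℝ, ∀ a b : Z, dist a b ≤ C)
    {x y x₂ y₂ x₃ y₃ : Z} (hxy : x ≠ y)
    (h : ∀ d ∈ LPM Z, d x y ≤ d x₂ y₂ + d x₃ y₃) :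
    x = x₂ ∨ x = y₂ ∨ x = x₃ ∨ x = y₃ := by
  by_contra hne
  obtain ⟨C, hC⟩ := hZ
  set S : Set Z := {y, x₂, y₂, x₃, y₃} with hS
  have hx : x ∉ S := by
    simp only [hS, Set.mem_insert_iff, Set.mem_singleton_iff]
    tauto
  have hpos : 0 < Metric.infDist x S :=
    ((Set.toFinite S).isClosed.notMem_iff_infDist_pos ⟨y, by simp [hS]⟩).1 hx
  have hz : ∀ w ∈ S, Metric.infDist w S = 0 := fun w hw => Metric.infDist_zero_of_mem hw
  have hlip : ∀ u v, |Metric.infDist u S - Metric.infDist v S| ≤ dist u v := fun u v => by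
    have := (Metric.lipschitz_infDist_pt S).dist_le_mul u v
    simpa [Real.dist_eq] using this
  have := h (fun u v => |Metric.infDist u S - Metric.infDist v S|)
    (mem_LPM_iff.2 ⟨isPseudometric_abs_sub _, ⟨C, fun u v => (hlip u v).trans (hC u v)⟩,
      1, by norm_num, fun u v => by simpa using hlip u v⟩)
  simp only [hz y (by simp [hS]), hz x₂ (by simp [hS]), hz y₂ (by simp [hS]),
    hz x₃ (by simp [hS]), hz y₃ (by simp [hS]), sub_zero, abs_zero, add_zero] at this
  rw [abs_of_pos hpos] at this
  linarith

lemma supDist_le_max_supNorm [Nonempty Z] {d e : Z → Z → ℝ} (hd : d ∈ LPM Z) (he : e ∈ LPM Z) :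
    supDist d e ≤ max (supDist 0 d) (supDist 0 e) := by
  rw [supDist_zero_left hd.1, supDist_zero_left he.1]
  refine supDist_le fun u v => ?_
  have h1 := LPM.le_supNorm hd u v
  have h2 := LPM.le_supNorm he u v
  have h3 := hd.1.nonneg u v
  have h4 := he.1.nonneg u v
  have h5 := le_max_left (supNorm d) (supNorm e)
  have h6 := le_max_right (supNorm d) (supNorm e)
  exact abs_le.2 ⟨by linarith, by linarith⟩

/-- The zero pseudometric is determined by the sup-metric on `LPM Z` alone. -/
lemma eq_zero_of_forall_supDist_le {a : Z → Z → ℝ} (ha : a ∈ LPM Z)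
    (h : ∀ d ∈ LPM Z, ∀ e ∈ LPM Z, supDist d e ≤ max (supDist a d) (supDist a e)) :
    a = 0 := by
  funext x y
  by_cases hxy : x = y
  · subst hxy
    exact ha.1.1 x
  have hD := dist_pos.2 hxy
  obtain ⟨t₀, ht₀⟩ := exists_supDist_peak_le ha hxy
  set t := max (max t₀ 0) ((supDist a 0 + 1) / dist x y)
  have h0 : 0 ≤ t := (le_max_right _ _).trans (le_max_left _ _)
  have h1 := ht₀ t ((le_max_left _ _).trans (le_max_left _ _))
  have h2 : supDist a 0 + 1 ≤ t * dist x y := (div_le_iff₀ hD).1 (le_max_right _ _)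
  have hm := LPM.const_mul (peak_mem_LPM x y) h0
  have h3 := h 0 zero_mem_LPM _ hm
  rw [supDist_zero_left hm.1, supNorm_const_mul_peak h0] at h3
  refine le_antisymm ?_ (ha.1.nonneg x y)
  change a x y ≤ 0
  rcases le_max_iff.1 h3 with h4 | h4 <;> linarith

end Pseudometrics

section Isometries

variable {X Y : Type*} [MetricSpace X] [MetricSpace Y]

lemma map_zero_of_isometry [Nonempty X] {T : (X → X → ℝ) → (Y → Y → ℝ)}
    (hbij : Set.BijOn T (LPM X) (LPM Y))
    (hiso : ∀ d ∈ LPM X, ∀ e ∈ LPM X, supDist (T d) (T e) = supDist d e) : T 0 = 0 := by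
  refine eq_zero_of_forall_supDist_le (hbij.mapsTo zero_mem_LPM) fun d' hd' e' he' => ?_
  obtain ⟨d, hd, rfl⟩ := hbij.surjOn hd'
  obtain ⟨e, he, rfl⟩ := hbij.surjOn he'
  rw [hiso _ hd _ he, hiso _ zero_mem_LPM _ hd, hiso _ zero_mem_LPM _ he]
  exact supDist_le_max_supNorm hd he

lemma exists_pair_forall_le [Nonempty X] {T : (X → X → ℝ) → (Y → Y → ℝ)}
    (hbij : Set.BijOn T (LPM X) (LPM Y))
    (hiso : ∀ d ∈ LPM X, ∀ e ∈ LPM X, supDist (T d) (T e) = supDist d e)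
    (hPp : Set.MapsTo T (Pp X ∩ LPM X) (Pp Y)) {x y : X} (hxy : x ≠ y) :
    ∃ u v : Y, u ≠ v ∧ ∀ d ∈ LPM X, d x y ≤ T d u v := by
  have hnorm : ∀ d ∈ LPM X, supNorm (T d) = supNorm d := fun d hd => by
    rw [← supDist_zero_left hd.1, ← supDist_zero_left (hbij.mapsTo hd).1,
      ← hiso _ zero_mem_LPM _ hd, map_zero_of_isometry hbij hiso]
  set p : ℝ → X → X → ℝ := fun t u v => t * peak x y u v with hp
  have pL : ∀ t, 0 ≤ t → p t ∈ LPM X := fun t ht => LPM.const_mul (peak_mem_LPM x y) ht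
  have pN : ∀ t, 0 ≤ t → supNorm (T (p t)) = t * dist x y := fun t ht => by
    rw [hnorm _ (pL t ht), supNorm_const_mul_peak ht]
  obtain ⟨-, u, v, huv, -, huniq⟩ := hPp (const_mul_peak_mem_Pp hxy one_pos)
  have hattain : ∀ t, 1 ≤ t → T (p t) u v = t * dist x y := fun t ht => by
    have ht0 : 0 ≤ t := by linarith
    obtain ⟨-, u', v', huv', hmax, -⟩ := hPp (const_mul_peak_mem_Pp hxy (one_pos.trans_le ht))
    change T (p t) u' v' = supNorm (T (p t)) at hmax
    rw [pN t ht0] at hmax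
    have h1 : |T (p t) u' v' - T (p 1) u' v'| ≤ (t - 1) * dist x y := by
      refine (LPM.abs_sub_le_supDist (hbij.mapsTo (pL t ht0))
        (hbij.mapsTo (pL 1 zero_le_one)) u' v').trans ?_
      rw [hiso _ (pL t ht0) _ (pL 1 zero_le_one)]
      refine supDist_le fun a b => ?_
      simp only [hp]
      rw [← sub_mul, abs_of_nonneg (mul_nonneg (by linarith) (abs_nonneg _))]
      exact mul_le_mul_of_nonneg_left (peak_le_dist _ _ _ _) (by linarith)
    have h2 := LPM.le_supNorm (hbij.mapsTo (pL 1 zero_le_one)) u' v'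
    have h3 : T (p 1) u' v' = supNorm (T (p 1)) := by
      rw [pN 1 zero_le_one] at h2 ⊢
      have := (abs_le.1 h1).2
      linarith
    have h4 := huniq u' v' huv' h3
    rcases Set.pair_eq_pair_iff.1 h4 with ⟨rfl, rfl⟩ | ⟨rfl, rfl⟩
    · exact hmax
    · rw [(hbij.mapsTo (pL t ht0)).1.2.1, hmax]
  refine ⟨u, v, huv, fun d hd => ?_⟩
  obtain ⟨t₀, ht₀⟩ := exists_supDist_peak_le hd hxy
  have h1 := ht₀ (max t₀ 1) (le_max_left _ _)
  have ht1 : 1 ≤ max t₀ 1 := le_max_right _ _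
  have hm := pL (max t₀ 1) (by linarith)
  have h2 := LPM.abs_sub_le_supDist (hbij.mapsTo hd) (hbij.mapsTo hm) u v
  rw [hiso _ hd _ hm, hattain _ ht1] at h2
  have h3 := (abs_le.1 h2).1
  change supDist d (p (max t₀ 1)) ≤ _ at h1
  linarith

lemma exists_pair_forall_ge [Nonempty X] [Nonempty Y] {T : (X → X → ℝ) → (Y → Y → ℝ)}
    (hbij : Set.BijOn T (LPM X) (LPM Y))
    (hiso : ∀ d ∈ LPM X, ∀ e ∈ LPM X, supDist (T d) (T e) = supDist d e)
    (hPp : T '' (Pp X ∩ LPM X) = Pp Y ∩ LPM Y) {u v : Y} (huv : u ≠ v) :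
    ∃ x y : X, x ≠ y ∧ ∀ d ∈ LPM X, T d u v ≤ d x y := by
  set S := Function.invFunOn T (LPM X) with hS
  have hinv : Set.InvOn S T (LPM X) (LPM Y) := hbij.invOn_invFunOn
  have hSbij : Set.BijOn S (LPM Y) (LPM X) := (Set.bijOn_comm hinv).2 hbij
  have hSiso : ∀ d ∈ LPM Y, ∀ e ∈ LPM Y, supDist (S d) (S e) = supDist d e :=
    fun d hd e he => by
      rw [← hiso _ (hSbij.mapsTo hd) _ (hSbij.mapsTo he), hinv.2 hd, hinv.2 he]
  have hSPp : Set.MapsTo S (Pp Y ∩ LPM Y) (Pp X) := by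
    rw [← hPp]
    rintro _ ⟨d, hd, rfl⟩
    rw [hinv.1 hd.2]
    exact hd.1
  obtain ⟨x, y, hxy, h⟩ := exists_pair_forall_le hSbij hSiso hSPp huv
  refine ⟨x, y, hxy, fun d hd => ?_⟩
  have := h _ (hbij.mapsTo hd)
  rwa [hinv.1 hd] at this

end Isometries

section Edges

variable {X Y : Type*}

/-- Three distinct edges, each of whose endpoints lies on another one of them, form a triangle. -/
lemma exists_triangle {e₁ e₂ e₃ : Sym2 X} (hd₁ : ¬ e₁.IsDiag) (hd₂ : ¬ e₂.IsDiag)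
    (hd₃ : ¬ e₃.IsDiag) (h₁₂ : e₁ ≠ e₂) (h₁₃ : e₁ ≠ e₃) (h₂₃ : e₂ ≠ e₃)
    (h₁ : ∀ x ∈ e₁, x ∈ e₂ ∨ x ∈ e₃) (h₂ : ∀ x ∈ e₂, x ∈ e₁ ∨ x ∈ e₃) :
    ∃ p q r, e₁ = s(p, q) ∧ e₂ = s(p, r) ∧ e₃ = s(q, r) := by
  induction e₁ with | _ a b
  induction e₂ with | _ c d
  induction e₃ with | _ e f
  simp only [Sym2.mem_iff, Sym2.mk_isDiag_iff, ne_eq, Sym2.eq_iff, forall_eq_or_imp,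
    forall_eq] at *
  by_cases hac : a = c
  · exact ⟨a, b, d, by grind⟩
  by_cases had : a = d
  · exact ⟨a, b, c, by grind⟩
  by_cases hbc : b = c
  · exact ⟨b, a, d, by grind⟩
  · exact ⟨b, a, c, by grind⟩

/-- An injective map of edges of complete graphs that preserves triangles and has every edge in its
range is induced by a bijection of the vertices. -/
lemma exists_equiv_of_edge_map [Nontrivial X] [Nontrivial Y] (E : Y → Y → Sym2 X)
    (hsymm : ∀ y a, E y a = E a y) (hdiag : ∀ y a, y ≠ a → ¬ (E y a).IsDiag)
    (hinj : ∀ y a u v, y ≠ a → u ≠ v → E y a = E u v → s(y, a) = s(u, v))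
    (hsurj : ∀ x x' : X, x ≠ x' → ∃ u v, u ≠ v ∧ E u v = s(x, x'))
    (htri : ∀ y a b, y ≠ a → y ≠ b → a ≠ b →
      ∃ p q r, E y a = s(p, q) ∧ E y b = s(p, r) ∧ E a b = s(q, r)) :
    ∃ φ : Y ≃ X, ∀ y a, y ≠ a → E y a = s(φ y, φ a) := by
  suffices h : ∃ φ : Y → X, ∀ y a, y ≠ a → E y a = s(φ y, φ a) by
    obtain ⟨φ, hφ⟩ := h
    refine ⟨Equiv.ofBijective φ ⟨fun y a hya => ?_, fun x => ?_⟩, hφ⟩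
    · by_contra hne
      exact hdiag y a hne (by rw [hφ y a hne, hya]; exact Sym2.diag_isDiag _)
    · obtain ⟨x', hx'⟩ := exists_ne x
      obtain ⟨u, v, huv, hE⟩ := hsurj x x' hx'.symm
      rw [hφ u v huv] at hE
      rcases Sym2.eq_iff.1 hE with ⟨h, -⟩ | ⟨-, h⟩
      exacts [⟨u, h⟩, ⟨v, h⟩]
  by_cases h3 : ∀ y a : Y, y ≠ a → ∃ b, b ≠ y ∧ b ≠ a
  · have hcommon : ∀ y, ∃ x, ∀ a, y ≠ a → x ∈ E y a := by
      intro y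
      obtain ⟨a, ha⟩ := exists_ne y
      obtain ⟨b, hby, hba⟩ := h3 y a ha.symm
      obtain ⟨p, q, r, h1, h2, h12⟩ := htri y a b ha.symm hby.symm hba.symm
      refine ⟨p, fun c hc => ?_⟩
      by_cases hca : c = a
      · subst hca
        simp [h1]
      by_cases hcb : c = b
      · subst hcb
        simp [h2]
      by_contra hp
      obtain ⟨p', q', r', k1, k2, -⟩ := htri y a c ha.symm hc (Ne.symm hca)
      obtain ⟨p'', q'', r'', m1, m2, -⟩ := htri y b c hby.symm hc (Ne.symm hcb)
      have heq : E y c = E a b := by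
        have hdc := hdiag a b hba.symm
        rw [h1] at k1
        rw [h2] at m1
        rw [h12] at hdc
        rw [h12]
        rw [Sym2.mk_isDiag_iff] at hdc
        have hq : q ∈ E y c := by
          have : p' ∈ s(p, q) := by simp [k1]
          have hp' : p' ∈ E y c := by simp [k2]
          rcases Sym2.mem_iff.1 this with rfl | rfl
          · exact absurd hp' hp
          · exact hp'
        have hr : r ∈ E y c := by
          have : p'' ∈ s(p, r) := by simp [m1]
          have hp' : p'' ∈ E y c := by simp [m2]
          rcases Sym2.mem_iff.1 this with rfl | rfl
          · exact absurd hp' hp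
          · exact hp'
        exact (Sym2.mem_and_mem_iff hdc).1 ⟨hq, hr⟩
      have := Sym2.eq_iff.1 (hinj y c a b hc hba.symm heq)
      grind
    choose φ hφ using hcommon
    refine ⟨φ, fun y a hya => ?_⟩
    have hne : φ y ≠ φ a := by
      intro heq
      obtain ⟨b, hby, hba⟩ := h3 y a hya
      obtain ⟨p, q, r, h1, h2, h12⟩ := htri y a b hya hby.symm hba.symm
      have k1 := hφ y a hya
      have k2 := hφ y b hby.symm
      have k3 := hφ a b hba.symm
      have d1 := hdiag y a hya
      have d2 := hdiag y b hby.symm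
      have d3 := hdiag a b hba.symm
      rw [← heq] at k3
      rw [h1] at k1 d1
      rw [h2] at k2 d2
      rw [h12] at k3 d3
      simp only [Sym2.mk_isDiag_iff, Sym2.mem_iff] at *
      grind
    refine (Sym2.mem_and_mem_iff hne).1 ⟨hφ y a hya, ?_⟩
    rw [hsymm]
    exact hφ a y hya.symm
  · push Not at h3
    obtain ⟨y₀, y₁, hne, hall⟩ := h3
    obtain ⟨⟨p, q⟩, hpq⟩ := Sym2.mk_surjective (E y₀ y₁)
    classical
    refine ⟨fun y => if y = y₀ then p else q, fun y a hya => ?_⟩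
    have hpq' : E y₁ y₀ = s(q, p) := by
      rw [hsymm, ← hpq]
      exact Sym2.eq_swap
    by_cases hy : y = y₀
    · have ha : a = y₁ := hall a (by rintro rfl; exact hya hy)
      subst hy ha
      simpa [hne.symm] using hpq.symm
    · have hy1 := hall y hy
      have ha : a = y₀ := by
        by_contra h
        exact hya (hy1.trans (hall a h).symm)
      subst hy1 ha
      simpa [hne.symm] using hpq'

end Edges


theorem stmt6 {X Y : Type*} [MetricSpace X] [MetricSpace Y]
    [Nontrivial X] [Nontrivial Y]
    (hX : ∃ C : ℝ, ∀ a b : X, dist a b ≤ C) (hY : ∃ C : ℝ, ∀ a b : Y, dist a b ≤ C)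
    (T : (X → X → ℝ) → (Y → Y → ℝ))
    (hbij : Set.BijOn T (LPM X) (LPM Y))
    (hiso : ∀ d ∈ LPM X, ∀ e ∈ LPM X, supDist (T d) (T e) = supDist d e)
    (hPp : T '' (Pp X ∩ LPM X) = Pp Y ∩ LPM Y) :
    (∃ φ : Y ≃ X,
      (∃ lam : ℝ, 1 ≤ lam ∧ ∀ x y : Y,
        (1 / lam) * dist x y ≤ dist (φ x) (φ y) ∧ dist (φ x) (φ y) ≤ lam * dist x y) ∧
      ∀ d ∈ LPM X, ∀ x y : Y, T d x y = d (φ x) (φ y)) ∧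
    (¬ ExactlyTwo X → ¬ ExactlyTwo Y →
      ∀ φ₁ φ₂ : Y ≃ X,
        ((∃ lam : ℝ, 1 ≤ lam ∧ ∀ x y : Y,
            (1 / lam) * dist x y ≤ dist (φ₁ x) (φ₁ y) ∧
              dist (φ₁ x) (φ₁ y) ≤ lam * dist x y) ∧
          ∀ d ∈ LPM X, ∀ x y : Y, T d x y = d (φ₁ x) (φ₁ y)) →
        ((∃ lam : ℝ, 1 ≤ lam ∧ ∀ x y : Y,
            (1 / lam) * dist x y ≤ dist (φ₂ x) (φ₂ y) ∧
              dist (φ₂ x) (φ₂ y) ≤ lam * dist x y) ∧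
          ∀ d ∈ LPM X, ∀ x y : Y, T d x y = d (φ₂ x) (φ₂ y)) →
        ∀ y : Y, φ₁ y = φ₂ y) := by
  have hE : ∀ u v : Y, u ≠ v → ∃ x x' : X, x ≠ x' ∧ ∀ d ∈ LPM X, T d u v = d x x' := by
    intro u v huv
    obtain ⟨x, x', hx, h⟩ := exists_pair_forall_ge hbij hiso hPp huv
    obtain ⟨u', v', hu', h'⟩ := exists_pair_forall_le hbij hiso
      (fun d hd => (hPp.subset ⟨d, hd, rfl⟩).1) hx
    have heq : s(u', v') = s(u, v) := by
      refine eq_of_forall_LPM_le huv fun e he => ?_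
      obtain ⟨d, hd, rfl⟩ := hbij.surjOn he
      exact (h d hd).trans (h' d hd)
    refine ⟨x, x', hx, fun d hd => le_antisymm (h d hd) ((h' d hd).trans ?_)⟩
    rcases Sym2.eq_iff.1 heq with ⟨rfl, rfl⟩ | ⟨rfl, rfl⟩
    · exact le_rfl
    · exact ((hbij.mapsTo hd).1.2.1 _ _).le
  have hE' : ∀ u v : Y, ∃ e : Sym2 X, u ≠ v → ¬ e.IsDiag ∧
      ∀ d ∈ LPM X, ∀ x x', e = s(x, x') → T d u v = d x x' := by
    intro u v
    by_cases huv : u = v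
    · obtain ⟨x⟩ : Nonempty X := inferInstance
      exact ⟨s(x, x), fun h => absurd huv h⟩
    · obtain ⟨x, x', hx, h⟩ := hE u v huv
      refine ⟨s(x, x'), fun _ => ⟨by simpa using hx, fun d hd p q hpq => ?_⟩⟩
      rcases Sym2.eq_iff.1 hpq with ⟨rfl, rfl⟩ | ⟨rfl, rfl⟩
      · exact h d hd
      · rw [h d hd, hd.1.2.1]
  choose E hE₀ using hE'
  have hdiag : ∀ u v, u ≠ v → ¬ (E u v).IsDiag := fun u v huv => (hE₀ u v huv).1
  have hval : ∀ u v, u ≠ v → ∀ d ∈ LPM X, ∀ x x', E u v = s(x, x') → T d u v = d x x' :=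
    fun u v huv => (hE₀ u v huv).2
  have heq_of_le : ∀ u v, u ≠ v → ∀ x x', (∀ d ∈ LPM X, T d u v ≤ d x x') →
      E u v = s(x, x') := by
    intro u v huv x x' h
    have hd := hdiag u v huv
    have hv := hval u v huv
    generalize E u v = e at *
    induction e with | _ p q
    rw [Sym2.mk_isDiag_iff] at hd
    refine (eq_of_forall_LPM_le hd fun d hd' => ?_).symm
    rw [← hv d hd' p q rfl]
    exact h d hd'
  have hsymm : ∀ u v, E u v = E v u := by
    intro u v
    by_cases huv : u = v
    · rw [huv]
    have hv := hval v u (Ne.symm huv)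
    generalize E v u = e at *
    induction e with | _ p q
    refine heq_of_le u v huv p q fun d hd => ?_
    rw [← hv d hd p q rfl, (hbij.mapsTo hd).1.2.1]
  have hinj : ∀ y a u v, y ≠ a → u ≠ v → E y a = E u v → s(y, a) = s(u, v) := by
    intro y a u v hya huv h
    have h1 := hval y a hya
    have h2 := hval u v huv
    rw [h] at h1
    generalize E u v = e at *
    induction e with | _ p q
    refine eq_of_forall_LPM_le huv fun e he => ?_
    obtain ⟨d, hd, rfl⟩ := hbij.surjOn he
    rw [h1 d hd p q rfl, h2 d hd p q rfl]
  have hsurj : ∀ x x' : X, x ≠ x' → ∃ u v, u ≠ v ∧ E u v = s(x, x') := by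
    intro x x' hx
    obtain ⟨u, v, huv, h⟩ := exists_pair_forall_le hbij hiso
      (fun d hd => (hPp.subset ⟨d, hd, rfl⟩).1) hx
    refine ⟨u, v, huv, ?_⟩
    have hv := hval u v huv
    generalize E u v = e at *
    induction e with | _ p q
    refine eq_of_forall_LPM_le hx fun d hd => ?_
    rw [← hv d hd p q rfl]
    exact h d hd
  have hmem : ∀ y a b, y ≠ a → y ≠ b → a ≠ b → ∀ x ∈ E y a, x ∈ E y b ∨ x ∈ E a b := by
    intro y a b hya hyb hab x hx
    have h1 := hval y a hya
    have h2 := hval y b hyb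
    have h3 := hval a b hab
    have hd := hdiag y a hya
    obtain ⟨x', hx'⟩ := Sym2.mem_iff_exists.1 hx
    generalize E y a = e₁ at *
    generalize E y b = e₂ at *
    generalize E a b = e₃ at *
    induction e₂ with | _ p q
    induction e₃ with | _ p' q'
    rw [hx', Sym2.mk_isDiag_iff] at hd
    simp only [Sym2.mem_iff, or_assoc]
    refine mem_of_forall_LPM_le_add hX hd fun d hd' => ?_
    rw [← h1 d hd' x x' hx', ← h2 d hd' p q rfl, ← h3 d hd' p' q' rfl,
      (hbij.mapsTo hd').1.2.1 a b]
    exact (hbij.mapsTo hd').1.2.2 y b a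
  have htri : ∀ y a b, y ≠ a → y ≠ b → a ≠ b →
      ∃ p q r, E y a = s(p, q) ∧ E y b = s(p, r) ∧ E a b = s(q, r) := by
    intro y a b hya hyb hab
    refine exists_triangle (hdiag y a hya) (hdiag y b hyb) (hdiag a b hab) ?_ ?_ ?_
      (hmem y a b hya hyb hab) fun x hx => ?_
    · intro h
      have := Sym2.eq_iff.1 (hinj _ _ _ _ hya hyb h)
      grind
    · intro h
      have := Sym2.eq_iff.1 (hinj _ _ _ _ hya hab h)
      grind
    · intro h
      have := Sym2.eq_iff.1 (hinj _ _ _ _ hyb hab h)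
      grind
    · rw [hsymm a b]
      exact hmem y b a hyb hya hab.symm x hx
  refine ⟨?_, ?_⟩
  · obtain ⟨φ, hφ⟩ := exists_equiv_of_edge_map E hsymm hdiag hinj hsurj htri
    have hT : ∀ d ∈ LPM X, ∀ x y : Y, T d x y = d (φ x) (φ y) := by
      intro d hd x y
      by_cases hxy : x = y
      · rw [hxy, hd.1.1, (hbij.mapsTo hd).1.1]
      · exact hval x y hxy d hd _ _ (hφ x y hxy)
    refine ⟨φ, ?_, hT⟩
    have hdX := dist_mem_LPM hX
    obtain ⟨d, hd, hdY⟩ := hbij.surjOn (dist_mem_LPM hY)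
    obtain ⟨-, -, L, -, hL⟩ := mem_LPM_iff.1 (hbij.mapsTo hdX)
    obtain ⟨-, -, L', -, hL'⟩ := mem_LPM_iff.1 hd
    have h1 : 1 ≤ max 1 (max L L') := le_max_left _ _
    have h2 : L ≤ max 1 (max L L') := (le_max_left _ _).trans (le_max_right _ _)
    have h3 : L' ≤ max 1 (max L L') := (le_max_right _ _).trans (le_max_right _ _)
    refine ⟨max 1 (max L L'), h1, fun x y => ⟨?_, ?_⟩⟩
    · rw [one_div, inv_mul_le_iff₀ (by linarith)]
      have h4 : dist x y = d (φ x) (φ y) := by rw [← hT d hd, hdY]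
      rw [h4]
      exact (hL' _ _).trans (mul_le_mul_of_nonneg_right h3 dist_nonneg)
    · have h4 := hL x y
      rw [hT _ hdX] at h4
      exact h4.trans (mul_le_mul_of_nonneg_right h2 dist_nonneg)
  · rintro - hY2 φ₁ φ₂ ⟨-, h₁⟩ ⟨-, h₂⟩ y
    have hpair : ∀ a, y ≠ a → s(φ₁ y, φ₁ a) = s(φ₂ y, φ₂ a) := fun a hya =>
      eq_of_forall_LPM_le (φ₂.injective.ne hya) fun d hd => by rw [← h₁ d hd, ← h₂ d hd]
    obtain ⟨a, ha⟩ := exists_ne y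
    obtain ⟨b, hby, hba⟩ : ∃ b, b ≠ y ∧ b ≠ a := by
      by_contra h
      push Not at h
      exact hY2 ⟨y, a, ha.symm, fun c => or_iff_not_imp_left.2 (h c)⟩
    have k1 := Sym2.eq_iff.1 (hpair a ha.symm)
    have k2 := Sym2.eq_iff.1 (hpair b hby.symm)
    have k3 := φ₂.injective.ne hba
    grind

end BanachStone
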